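/- Let 0 < m ≤ M, 0 ≤ H_n ≤ (M−m)/M, 0 ≤ H_p ≤ (M−m)/m, and suppose (1+H_p)/(1−H_n) ≤ √(M/m). Let p ∈ [m, M] and let σ be a nonempty finite sequence of prices in [m, M] with best price p* = max σ = p(1+η) for some η ∈ [0, H_p] (positive error at most H_p). Then the algorithm Robust-Mix, which in this case uses reservation price p' = p(1−H_n), satisfies p* / RP(p', σ) ≤ (1+η)/(1−H_n) ≤ √(M/m); in particular p*/RP(p', σ) ≤ min{(1+η)/(1−H_n), √(M/m)}. (Theorem 3, positive-error case.) -/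

import Mathlib

/-- Profit of the reservation algorithm with reservation price `q` on a price
sequence: the first price that is at least `q`, or the last price if none. -/
noncomputable def RP (q : ℝ) : List ℝ → ℝ
  | [] => 0
  | [x] => x
  | x :: xs => if q ≤ x then x else RP q xs

/-- If some price reaches the reservation price, the profit is at least the reservation price. -/
theorem le_RP_of_mem {q y : ℝ} (hqy : q ≤ y) : ∀ {σ : List ℝ}, y ∈ σ → q ≤ RP q σ
  | [x], h => by
    rw [List.mem_singleton] at h
    subst h
    simpa only [RP] using hqy
  | x :: z :: xs, h => by
    rw [RP.eq_3 q x (z :: xs) (by simp)]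
    split_ifs with hx
    · exact hx
    · rcases List.mem_cons.mp h with rfl | h
      · exact absurd hqy hx
      · exact le_RP_of_mem hqy h

theorem stmt7 (m M Hn Hp p η pstar : ℝ) (σ : List ℝ)
    (hm : 0 < m) (hmM : m ≤ M)
    (hHn0 : 0 ≤ Hn) (hHn : Hn ≤ (M - m) / M)
    (hHp0 : 0 ≤ Hp) (hHp : Hp ≤ (M - m) / m)
    (hcond : (1 + Hp) / (1 - Hn) ≤ Real.sqrt (M / m))
    (hp : p ∈ Set.Icc m M)
    (hσ : ∀ x ∈ σ, x ∈ Set.Icc m M)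
    (hmem : pstar ∈ σ) (hmax : ∀ x ∈ σ, x ≤ pstar)
    (hη : η ∈ Set.Icc 0 Hp) (herr : pstar = p * (1 + η)) :
    pstar / RP (p * (1 - Hn)) σ ≤ (1 + η) / (1 - Hn) ∧
    (1 + η) / (1 - Hn) ≤ Real.sqrt (M / m) ∧
    pstar / RP (p * (1 - Hn)) σ ≤ min ((1 + η) / (1 - Hn)) (Real.sqrt (M / m)) := by
  obtain ⟨hη0, hηH⟩ := hη
  have hp0 : 0 < p := hm.trans_le hp.1
  have hHn1 : 0 < 1 - Hn := by
    have hM : 0 < M := hm.trans_le hmM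
    rw [le_div_iff₀ hM] at hHn
    nlinarith
  have hq : 0 < p * (1 - Hn) := mul_pos hp0 hHn1
  have hRP : p * (1 - Hn) ≤ RP (p * (1 - Hn)) σ :=
    le_RP_of_mem (by rw [herr]; gcongr; linarith) hmem
  have hratio : pstar / RP (p * (1 - Hn)) σ ≤ (1 + η) / (1 - Hn) := by
    calc pstar / RP (p * (1 - Hn)) σ ≤ pstar / (p * (1 - Hn)) := by
          have : 0 ≤ pstar := by rw [herr]; positivity
          gcongr
      _ = (1 + η) / (1 - Hn) := by rw [herr, mul_div_mul_left _ _ hp0.ne']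
  have hbound : (1 + η) / (1 - Hn) ≤ Real.sqrt (M / m) :=
    le_trans (by gcongr) hcond
  exact ⟨hratio, hbound, le_min hratio (hratio.trans hbound)⟩
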